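/- Let x̄ ∈ Ω and ε ≥ 0. Then every ε-subgradient x* ∈ ∂̂_ε T(x̄) of the minimal time function at x̄ satisfies x* ∈ N̂_ε(x̄; Ω) and σ_F(−x*) ≤ 1 + ε·‖F‖; that is, ∂̂_ε T(x̄) ⊆ N̂_ε(x̄; Ω) ∩ C*_ε. -/

import Mathlib

open Set Filter Topology Pointwise
open scoped ENNReal

variable {X : Type*}

/-- Minimal time function `T(x) = inf{t ≥ 0 : Ω ∩ (x + tF) ≠ ∅}`, with `inf ∅ = ∞`. -/
noncomputable def mtime [NormedAddCommGroup X] [NormedSpace ℝ X]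
    (Ω F : Set X) (x : X) : ℝ≥0∞ :=
  ⨅ (t : ℝ) (_ : 0 ≤ t ∧ ∃ q ∈ F, x + t • q ∈ Ω), ENNReal.ofReal t

/-- Minkowski gauge `ρ_F(u) = inf{t ≥ 0 : u ∈ tF}`, with `inf ∅ = ∞`. -/
noncomputable def mgauge [NormedAddCommGroup X] [NormedSpace ℝ X]
    (F : Set X) (u : X) : ℝ≥0∞ :=
  ⨅ (t : ℝ) (_ : 0 ≤ t ∧ ∃ q ∈ F, u = t • q), ENNReal.ofReal t

/-- Enlargement `Ω_r = {x : T(x) ≤ r}` of the target set. -/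
noncomputable def enl [NormedAddCommGroup X] [NormedSpace ℝ X]
    (Ω F : Set X) (r : ℝ) : Set X :=
  {x | mtime Ω F x ≤ ENNReal.ofReal r}

/-- Generalized (minimal time) projection `Π(x) = (x + T(x)·F) ∩ Ω`. -/
noncomputable def mproj [NormedAddCommGroup X] [NormedSpace ℝ X]
    (Ω F : Set X) (x : X) : Set X :=
  {w | w ∈ Ω ∧ ∃ q ∈ F, w = x + (mtime Ω F x).toReal • q}

/-- Support function `σ_F(x*) = sup_{q ∈ F} ⟨x*, q⟩`. -/
noncomputable def suppFn [NormedAddCommGroup X] [NormedSpace ℝ X]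
    (F : Set X) (p : X →L[ℝ] ℝ) : ℝ :=
  sSup ((fun q => p q) '' F)

/-- Dynamics bound `‖F‖ = sup{‖q‖ : q ∈ F}`. -/
noncomputable def dynBound [NormedAddCommGroup X] (F : Set X) : ℝ :=
  sSup ((fun q => ‖q‖) '' F)

/-- Fréchet `ε`-subdifferential of `φ` at `xb`:
`liminf_{x→xb} (φ(x) − φ(xb) − ⟨x*, x−xb⟩)/‖x−xb‖ ≥ −ε`. -/
def fsub [NormedAddCommGroup X] [NormedSpace ℝ X]
    (φ : X → ℝ≥0∞) (ε : ℝ) (xb : X) : Set (X →L[ℝ] ℝ) :=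
  {p | ∀ γ > (0:ℝ), ∃ δ > (0:ℝ), ∀ x, ‖x - xb‖ < δ →
    ENNReal.ofReal ((φ xb).toReal + p (x - xb) - (ε + γ) * ‖x - xb‖) ≤ φ x}

/-- Set of `ε`-normals to `Θ` at `xb ∈ Θ`. -/
def enormal [NormedAddCommGroup X] [NormedSpace ℝ X]
    (Θ : Set X) (ε : ℝ) (xb : X) : Set (X →L[ℝ] ℝ) :=
  {p | ∀ γ > (0:ℝ), ∃ δ > (0:ℝ), ∀ x ∈ Θ, ‖x - xb‖ < δ →
    p (x - xb) ≤ (ε + γ) * ‖x - xb‖}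

/-- Basic (limiting/Mordukhovich) normal cone. -/
def bnormal [NormedAddCommGroup X] [NormedSpace ℝ X]
    (Θ : Set X) (xb : X) : Set (X →L[ℝ] ℝ) :=
  {p | ∃ (ε : ℕ → ℝ) (x : ℕ → X) (ps : ℕ → X →L[ℝ] ℝ),
    (∀ k, 0 ≤ ε k) ∧ Tendsto ε atTop (𝓝 0) ∧
    (∀ k, x k ∈ Θ) ∧ Tendsto x atTop (𝓝 xb) ∧
    (∀ k, ps k ∈ enormal Θ (ε k) (x k)) ∧
    (∀ v, Tendsto (fun k => ps k v) atTop (𝓝 (p v)))}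

/-- Basic (limiting/Mordukhovich) subdifferential. -/
def bsub [NormedAddCommGroup X] [NormedSpace ℝ X]
    (φ : X → ℝ≥0∞) (xb : X) : Set (X →L[ℝ] ℝ) :=
  {p | ∃ (ε : ℕ → ℝ) (x : ℕ → X) (ps : ℕ → X →L[ℝ] ℝ),
    (∀ k, 0 ≤ ε k) ∧ Tendsto ε atTop (𝓝 0) ∧
    Tendsto x atTop (𝓝 xb) ∧
    Tendsto (fun k => φ (x k)) atTop (𝓝 (φ xb)) ∧
    (∀ k, ps k ∈ fsub φ (ε k) (x k)) ∧
    (∀ v, Tendsto (fun k => ps k v) atTop (𝓝 (p v)))}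

/-- Singular (Mordukhovich) subdifferential. -/
def ssub [NormedAddCommGroup X] [NormedSpace ℝ X]
    (φ : X → ℝ≥0∞) (xb : X) : Set (X →L[ℝ] ℝ) :=
  {p | ∃ (ε lam : ℕ → ℝ) (x : ℕ → X) (ps : ℕ → X →L[ℝ] ℝ),
    (∀ k, 0 ≤ ε k) ∧ Tendsto ε atTop (𝓝 0) ∧
    (∀ k, 0 < lam k) ∧ Tendsto lam atTop (𝓝 0) ∧
    Tendsto x atTop (𝓝 xb) ∧
    Tendsto (fun k => φ (x k)) atTop (𝓝 (φ xb)) ∧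
    (∀ k, ps k ∈ fsub φ (ε k) (x k)) ∧
    (∀ v, Tendsto (fun k => lam k * ps k v) atTop (𝓝 (p v)))}

/-- Subdifferential of convex analysis (for `ℝ≥0∞`-valued convex functions,
finite at the reference point). -/
def csub [NormedAddCommGroup X] [NormedSpace ℝ X]
    (φ : X → ℝ≥0∞) (xb : X) : Set (X →L[ℝ] ℝ) :=
  {p | ∀ x, ENNReal.ofReal (p (x - xb) + (φ xb).toReal) ≤ φ x}

/-- Normal cone of convex analysis. -/
def cnormal [NormedAddCommGroup X] [NormedSpace ℝ X]
    (Θ : Set X) (xb : X) : Set (X →L[ℝ] ℝ) :=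
  {p | ∀ x ∈ Θ, p (x - xb) ≤ 0}

theorem mtime_le_ofReal [NormedAddCommGroup X] [NormedSpace ℝ X] {Ω F : Set X} {x q : X} {t : ℝ}
    (ht : 0 ≤ t) (hq : q ∈ F) (hx : x + t • q ∈ Ω) : mtime Ω F x ≤ ENNReal.ofReal t :=
  iInf₂_le t ⟨ht, q, hq, hx⟩

theorem mtime_eq_zero_of_mem [NormedAddCommGroup X] [NormedSpace ℝ X] {Ω F : Set X} {x : X}
    (hF : F.Nonempty) (hx : x ∈ Ω) : mtime Ω F x = 0 := by
  obtain ⟨q, hq⟩ := hF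
  simpa using mtime_le_ofReal (t := 0) le_rfl hq (by simpa using hx)

/-- An `ε`-subgradient `p` of the minimal time function at a point of the target grows at rate
at most `1 + ε * ‖q‖` in the direction `-q`, for every velocity `q` of the dynamics. -/
theorem neg_apply_le_of_mem_fsub_mtime [NormedAddCommGroup X] [NormedSpace ℝ X]
    {Ω F : Set X} {xb q : X} {ε : ℝ} {p : X →L[ℝ] ℝ} (hxb : xb ∈ Ω) (hq : q ∈ F)
    (hp : p ∈ fsub (mtime Ω F) ε xb) : -p q ≤ 1 + ε * ‖q‖ := by
  have approx : ∀ γ > (0 : ℝ), -p q ≤ 1 + (ε + γ) * ‖q‖ := by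
    intro γ hγ
    obtain ⟨δ, hδ, h⟩ := hp γ hγ
    have hpos : 0 < ‖q‖ + 1 := by positivity
    set t : ℝ := δ / (‖q‖ + 1) with ht_def
    have ht : 0 < t := by positivity
    have htδ : t * (‖q‖ + 1) = δ := by rw [ht_def]; field_simp
    have hsub : xb - t • q - xb = -(t • q) := by abel
    have hnorm : ‖xb - t • q - xb‖ = t * ‖q‖ := by
      rw [hsub, norm_neg, norm_smul, Real.norm_of_nonneg ht.le]
    have hle := (h (xb - t • q) (by rw [hnorm]; linarith)).trans
      (mtime_le_ofReal ht.le hq (by simpa using hxb))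
    rw [ENNReal.ofReal_le_ofReal_iff ht.le, hnorm, hsub,
      mtime_eq_zero_of_mem ⟨q, hq⟩ hxb] at hle
    simp only [ENNReal.toReal_zero, map_neg, map_smul, smul_eq_mul] at hle
    refine le_of_mul_le_mul_left ?_ ht
    linarith
  have hlim : Tendsto (fun γ : ℝ => 1 + (ε + γ) * ‖q‖) (𝓝[>] 0) (𝓝 (1 + (ε + 0) * ‖q‖)) :=
    (Continuous.tendsto (by fun_prop) 0).mono_left nhdsWithin_le_nhds
  rw [add_zero] at hlim
  exact ge_of_tendsto hlim (eventually_mem_nhdsWithin.mono approx)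

/-- Proposition 4.1: upper estimate of `ε`-subdifferentials of minimal time
functions at in-set points: `∂̂_ε T(x̄) ⊆ N̂_ε(x̄; Ω) ∩ C*_ε`. -/
theorem fsub_mtime_subset_inset [NormedAddCommGroup X] [NormedSpace ℝ X]
    [CompleteSpace X]
    (Ω F : Set X) (hΩne : Ω.Nonempty) (hΩcl : IsClosed Ω)
    (hFne : F.Nonempty) (hFcl : IsClosed F) (hFbd : Bornology.IsBounded F)
    (hFcv : Convex ℝ F)
    (xb : X) (hxb : xb ∈ Ω) (ε : ℝ) (hε : 0 ≤ ε) :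
    fsub (mtime Ω F) ε xb ⊆
      enormal Ω ε xb ∩ {p | suppFn F (-p) ≤ 1 + ε * dynBound F} := by
  intro p hp
  refine ⟨fun γ hγ => ?_, ?_⟩
  · obtain ⟨δ, hδ, h⟩ := hp γ hγ
    refine ⟨δ, hδ, fun x hx hxδ => ?_⟩
    have hle := h x hxδ
    rw [mtime_eq_zero_of_mem hFne hx, mtime_eq_zero_of_mem hFne hxb, nonpos_iff_eq_zero,
      ENNReal.ofReal_eq_zero, ENNReal.toReal_zero] at hle
    linarith
  · rw [mem_ofPred_eq, suppFn]
    refine csSup_le (hFne.image _) ?_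
    rintro _ ⟨q, hq, rfl⟩
    have hbdd : BddAbove ((fun q => ‖q‖) '' F) := by
      obtain ⟨C, hC⟩ := hFbd.exists_norm_le
      exact ⟨C, forall_mem_image.2 hC⟩
    have hq_le : ‖q‖ ≤ dynBound F := le_csSup hbdd (mem_image_of_mem _ hq)
    calc (-p) q ≤ 1 + ε * ‖q‖ := neg_apply_le_of_mem_fsub_mtime hxb hq hp
      _ ≤ 1 + ε * dynBound F := by gcongr
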